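/- Let n ≥ 2 and let μ be the normalized kinematic measure on directed lines meeting the unit sphere S^{n−1} ⊂ ℝⁿ. Then the pushforward of μ under the entry-point map (v, z) ↦ X(v,z) equals the uniform probability (normalized surface) measure σ on S^{n−1}; likewise the pushforward under the exit-point map (v, z) ↦ Y(v,z) equals σ. That is, each of the two intersection points of a random line with the sphere is uniformly distributed on S^{n−1}. -/

import Mathlib

open MeasureTheory Metric Real Filter
open scoped ENNReal RealInnerProductSpace Topology

noncomputable section

/-- Euclidean space `ℝⁿ`. -/
abbrev En (n : ℕ) := EuclideanSpace ℝ (Fin n)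

/-- The unit sphere `S^{n-1} ⊂ ℝⁿ`. -/
def unitSphere (n : ℕ) : Set (En n) := Metric.sphere 0 1

/-- The uniform probability (normalized surface) measure on the unit sphere. -/
def sigmaN (n : ℕ) : Measure (En n) :=
  (μH[(n : ℝ) - 1] (unitSphere n))⁻¹ •
    (μH[(n : ℝ) - 1] : Measure (En n)).restrict (unitSphere n)

/-- The open unit disc in the hyperplane orthogonal to `v`. -/
def disc (n : ℕ) (v : En n) : Set (En n) := {z | ⟪v, z⟫ = 0 ∧ ‖z‖ < 1}

/-- Normalized `(n-1)`-dimensional Hausdorff measure on the disc `{z ∈ v⊥ : ‖z‖ < 1}`. -/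
def lambdaN (n : ℕ) (v : En n) : Measure (En n) :=
  (μH[(n : ℝ) - 1] (disc n v))⁻¹ •
    (μH[(n : ℝ) - 1] : Measure (En n)).restrict (disc n v)

/-- The normalized kinematic measure on directed lines meeting the unit sphere,
parametrized by pairs `(v, z)` with `v` the direction and `z ∈ v⊥`, `‖z‖ < 1`. -/
def kinematic (n : ℕ) : Measure (En n × En n) :=
  (sigmaN n).bind (fun v => (Measure.dirac v).prod (lambdaN n v))

/-- The entry point of the line parametrized by `(v, z)` in the unit sphere. -/
def Xpt (n : ℕ) (p : En n × En n) : En n := p.2 - Real.sqrt (1 - ‖p.2‖ ^ 2) • p.1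

/-- The exit point of the line parametrized by `(v, z)` in the unit sphere. -/
def Ypt (n : ℕ) (p : En n × En n) : En n := p.2 + Real.sqrt (1 - ‖p.2‖ ^ 2) • p.1


/-- Two finite reflection-invariant measures on the unit sphere with equal mass agree. -/
lemma invariant_unique {n : ℕ} (μ ν : Measure (En n)) [IsFiniteMeasure μ]
    [IsFiniteMeasure ν]
    (hμ : ∀ U : En n ≃ₗᵢ[ℝ] En n, μ.map U = μ) (hν : ∀ U : En n ≃ₗᵢ[ℝ] En n, ν.map U = ν)
    (hμs : ∀ᵐ x ∂μ, ‖x‖ = 1) (hνs : ∀ᵐ x ∂ν, ‖x‖ = 1) (h : μ Set.univ = ν Set.univ) :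
    μ = ν := by
  by_cases h0 : ν Set.univ = 0
  · rw [Measure.measure_univ_eq_zero.1 h0, Measure.measure_univ_eq_zero.1 (h.trans h0)]
  have hinv : ∀ ρ : Measure (En n), (∀ U : En n ≃ₗᵢ[ℝ] En n, ρ.map U = ρ) →
      ∀ s t : En n, ‖s‖ = ‖t‖ → charFun ρ s = charFun ρ t := by
    intro ρ hρ s t hst
    let U := (ℝ ∙ (s - t))ᗮ.reflection
    have hU : U s = t := Submodule.reflection_sub hst
    rw [charFun_apply, charFun_apply]
    conv_rhs => rw [← hρ U]
    rw [integral_map (by fun_prop) (by fun_prop)]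
    congr 1
    ext x
    rw [← hU, U.inner_map_map]
  have hr : μ.real Set.univ = ν.real Set.univ := by simp [Measure.real, h]
  have hr0 : (ν.real Set.univ : ℂ) ≠ 0 := by
    simp [Measure.real, ENNReal.toReal_eq_zero_iff, h0]
  have key : ∀ (μ ν : Measure (En n)) [IsFiniteMeasure μ] [IsFiniteMeasure ν],
      (∀ U : En n ≃ₗᵢ[ℝ] En n, μ.map U = μ) → (∀ᵐ x ∂ν, ‖x‖ = 1) → ∀ t : En n,
      (ν.real Set.univ : ℂ) * charFun μ t = ∫ u, ∫ x, Complex.exp (⟪x, ‖t‖ • u⟫ * Complex.I) ∂μ ∂ν := by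
    intro μ ν _ _ hμ hνs t
    have : ∀ᵐ u ∂ν, ∫ x, Complex.exp (⟪x, ‖t‖ • u⟫ * Complex.I) ∂μ = charFun μ t := by
      filter_upwards [hνs] with u hu
      rw [← charFun_apply]
      apply hinv μ hμ
      simp [norm_smul, hu]
    rw [integral_congr_ae this]
    simp
  apply Measure.ext_of_charFun
  ext t
  apply mul_left_cancel₀ hr0
  rw [key μ ν hμ hνs t, ← hr, key ν μ hν hμs t, integral_integral_swap]
  · congr 1
    ext u
    congr 1
    ext x
    rw [inner_smul_right, inner_smul_right, real_inner_comm]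
  · apply Integrable.of_bound (C := 1)
    · apply Continuous.aestronglyMeasurable
      unfold Function.uncurry
      fun_prop
    · refine Eventually.of_forall fun x => ?_
      simp [Function.uncurry, Complex.norm_exp]

lemma map_sigmaN {n : ℕ} (U : En n ≃ₗᵢ[ℝ] En n) : (sigmaN n).map U = sigmaN n := by
  unfold sigmaN
  have hm : Measurable U := U.continuous.measurable
  have hp : U ⁻¹' (unitSphere n) = unitSphere n := by
    ext x; simp [unitSphere]
  rw [Measure.map_smul]
  congr 1
  conv_lhs => rw [← hp]
  rw [← Measure.restrict_map hm (show MeasurableSet (unitSphere n) from isClosed_sphere.measurableSet)]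
  congr 1
  exact U.toIsometryEquiv.map_hausdorffMeasure _

lemma measurableSet_disc {n : ℕ} (v : En n) : MeasurableSet (disc n v) := by
  have h1 : MeasurableSet {z : En n | ⟪v, z⟫ = 0} :=
    (isClosed_eq (by fun_prop) (by fun_prop)).measurableSet
  have h2 : MeasurableSet {z : En n | ‖z‖ < 1} :=
    (isOpen_lt (by fun_prop) (by fun_prop)).measurableSet
  exact h1.inter h2

lemma map_lambdaN {n : ℕ} (U : En n ≃ₗᵢ[ℝ] En n) (v : En n) :
    (lambdaN n v).map U = lambdaN n (U v) := by
  unfold lambdaN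
  have hm : Measurable U := U.continuous.measurable
  have hp : U ⁻¹' (disc n (U v)) = disc n v := by
    ext x; simp [disc]
  have hH : Measure.map U (μH[(n : ℝ) - 1] : Measure (En n)) = μH[(n : ℝ) - 1] :=
    U.toIsometryEquiv.map_hausdorffMeasure _
  have hd : (μH[(n : ℝ) - 1] : Measure (En n)) (disc n v) = μH[(n : ℝ) - 1] (disc n (U v)) := by
    conv_rhs => rw [← hH]
    rw [Measure.map_apply hm (measurableSet_disc _), hp]
  rw [Measure.map_smul, hd]
  congr 1
  conv_lhs => rw [← hp]
  rw [← Measure.restrict_map hm (measurableSet_disc _), hH]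

lemma lambdaN_prob {n : ℕ} (hn : 2 ≤ n) {v : En n} (hv : v ≠ 0) :
    IsProbabilityMeasure (lambdaN n v) := by
  obtain ⟨m, rfl⟩ : ∃ m, n = m + 1 := ⟨n - 1, by omega⟩
  have : Fact (Module.finrank ℝ (En (m + 1)) = m + 1) := ⟨by simp⟩
  let W := (ℝ ∙ v)ᗮ
  have hW : Module.finrank ℝ W = m := Submodule.finrank_orthogonal_span_singleton hv
  have hi : disc (m + 1) v = ((↑) : W → En (m + 1)) '' ball (0 : W) 1 := by
    ext x
    simp only [disc, Set.mem_ofPred_eq, Set.mem_image, mem_ball_zero_iff]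
    constructor
    · rintro ⟨h1, h2⟩
      exact ⟨⟨x, Submodule.mem_orthogonal_singleton_iff_inner_right.2 h1⟩, h2, rfl⟩
    · rintro ⟨y, hy, rfl⟩
      exact ⟨Submodule.mem_orthogonal_singleton_iff_inner_right.1 y.2, hy⟩
  have hH : (μH[((m + 1 : ℕ) : ℝ) - 1] : Measure (En (m + 1))) (disc (m + 1) v)
      = μH[(Module.finrank ℝ W : ℝ)] (ball (0 : W) 1) := by
    rw [hi, isometry_subtype_coe.hausdorffMeasure_image (Or.inl (by simp)), hW]
    simp
  have h0 : (μH[((m + 1 : ℕ) : ℝ) - 1] : Measure (En (m + 1))) (disc (m + 1) v) ≠ 0 := by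
    rw [hH]
    exact (measure_ball_pos _ _ one_pos).ne'
  have h1 : (μH[((m + 1 : ℕ) : ℝ) - 1] : Measure (En (m + 1))) (disc (m + 1) v) ≠ ⊤ := by
    rw [hH]
    exact measure_ball_lt_top.ne
  constructor
  simp only [lambdaN, Measure.smul_apply, Measure.restrict_apply_univ, smul_eq_mul]
  exact ENNReal.inv_mul_cancel h0 h1

lemma sigmaN_finite (n : ℕ) : IsFiniteMeasure (sigmaN n) := by
  constructor
  simp only [sigmaN, Measure.smul_apply, Measure.restrict_apply_univ, smul_eq_mul]
  exact lt_of_le_of_lt (ENNReal.inv_mul_le_one _) ENNReal.one_lt_top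

lemma sigmaN_ae (n : ℕ) : ∀ᵐ v ∂(sigmaN n), ‖v‖ = 1 := by
  unfold sigmaN
  apply Measure.ae_smul_measure
  filter_upwards [ae_restrict_mem (show MeasurableSet (unitSphere n) from isClosed_sphere.measurableSet)] with v hv
  simpa [unitSphere] using hv

lemma lambdaN_ae (n : ℕ) (v : En n) : ∀ᵐ z ∂(lambdaN n v), z ∈ disc n v := by
  unfold lambdaN
  apply Measure.ae_smul_measure
  exact ae_restrict_mem (measurableSet_disc v)

lemma kernel_aemeasurable {n : ℕ} (hn : 2 ≤ n) :
    AEMeasurable (fun v => (Measure.dirac v).prod (lambdaN n v)) (sigmaN n) := by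
  let e : En n := EuclideanSpace.single ⟨0, by omega⟩ 1
  have he : ‖e‖ = 1 := by simp [e]
  have he0 : e ≠ 0 := by intro h; simp [h] at he
  have := lambdaN_prob hn he0
  let R : En n × En n → En n × En n := fun p =>
    (p.1, -((2 : ℕ) • (⟪e - p.1, p.2⟫ / (‖e - p.1‖ ^ 2)) • (e - p.1) - p.2))
  have hR : Measurable R := by fun_prop
  refine ⟨fun v => ((lambdaN n e).map (Prod.mk v)).map R, ?_, ?_⟩
  · exact (Measure.measurable_map R hR).comp Measurable.map_prodMk_left
  · filter_upwards [sigmaN_ae n] with v hv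
    have hv0 : v ≠ 0 := by intro h; simp [h] at hv
    have := lambdaN_prob hn hv0
    let U := (ℝ ∙ (e - v))ᗮ.reflection
    have hU : U e = v := Submodule.reflection_sub (by rw [he, hv])
    rw [Measure.dirac_prod]
    conv_lhs => rw [← hU, ← map_lambdaN U e]
    rw [hU, Measure.map_map (by fun_prop) U.continuous.measurable, Measure.map_map hR (by fun_prop)]
    congr 1
    ext1 z
    simp only [Function.comp, R, U]
    rw [Submodule.reflection_orthogonal_apply, Submodule.reflection_singleton_apply]
    rfl

lemma map_kinematic {n : ℕ} (hn : 2 ≤ n) (F : En n × En n → En n) (hF : Measurable F)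
    (hU : ∀ (U : En n ≃ₗᵢ[ℝ] En n) v z, F (U v, U z) = U (F (v, z)))
    (hs : ∀ v z, ‖v‖ = 1 → z ∈ disc n v → ‖F (v, z)‖ = 1) :
    Measure.map F (kinematic n) = sigmaN n := by
  have := sigmaN_finite n
  have happ : ∀ A, MeasurableSet A → (Measure.map F (kinematic n)) A =
      ∫⁻ v, lambdaN n v {z | F (v, z) ∈ A} ∂(sigmaN n) := by
    intro A hA
    rw [Measure.map_apply hF hA, kinematic, Measure.bind_apply (hF hA) (kernel_aemeasurable hn)]
    apply lintegral_congr_ae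
    filter_upwards [sigmaN_ae n] with v hv
    have hv0 : v ≠ 0 := by intro h; simp [h] at hv
    have := lambdaN_prob hn hv0
    rw [Measure.dirac_prod, Measure.map_apply (by fun_prop) (hF hA)]
    rfl
  have hmass : (Measure.map F (kinematic n)) Set.univ = sigmaN n Set.univ := by
    rw [happ _ MeasurableSet.univ, ← lintegral_one]
    apply lintegral_congr_ae
    filter_upwards [sigmaN_ae n] with v hv
    have hv0 : v ≠ 0 := by intro h; simp [h] at hv
    have := lambdaN_prob hn hv0
    simp
  have : IsFiniteMeasure (Measure.map F (kinematic n)) := ⟨by rw [hmass]; exact measure_lt_top _ _⟩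
  refine invariant_unique _ _ ?_ (fun U => map_sigmaN U) ?_ (sigmaN_ae n) hmass
  · intro U
    have hm : Measurable U := U.continuous.measurable
    ext A hA
    rw [Measure.map_apply hm hA, happ _ (hm hA), happ _ hA]
    conv_rhs => rw [← map_sigmaN U]
    have := lintegral_map_equiv (μ := sigmaN n) (fun v => lambdaN n v {z | F (v, z) ∈ A})
      U.toHomeomorph.toMeasurableEquiv
    refine Eq.trans ?_ this.symm
    apply lintegral_congr
    intro v
    change _ = lambdaN n (U v) {z | F (U v, z) ∈ A}
    have hA' : MeasurableSet {z | F (U v, z) ∈ A} :=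
      (hF.comp measurable_prodMk_left) hA
    rw [← map_lambdaN, Measure.map_apply hm hA']
    congr 1
    ext z
    simp [hU]
  · have hS : MeasurableSet {x : En n | ¬ ‖x‖ = 1} :=
      (isClosed_eq (by fun_prop) (by fun_prop)).measurableSet.compl
    rw [ae_iff, happ _ hS]
    apply (lintegral_eq_zero_of_ae_eq_zero)
    filter_upwards [sigmaN_ae n] with v hv
    apply (ae_iff (p := fun z => ‖F (v, z)‖ = 1)).1
    filter_upwards [lambdaN_ae n v] with z hz
    exact hs v z hv hz

lemma norm_pt {n : ℕ} (s : ℝ) (hs : s ^ 2 = 1) (v z : En n) (hv : ‖v‖ = 1) (hz : z ∈ disc n v) :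
    ‖z + (s * Real.sqrt (1 - ‖z‖ ^ 2)) • v‖ = 1 := by
  obtain ⟨h1, h2⟩ := hz
  have h3 : 0 ≤ 1 - ‖z‖ ^ 2 := by nlinarith [norm_nonneg z]
  have : ‖z + (s * Real.sqrt (1 - ‖z‖ ^ 2)) • v‖ ^ 2 = 1 := by
    rw [norm_add_sq_real, inner_smul_right, real_inner_comm, h1, norm_smul, hv, mul_one,
      Real.norm_eq_abs, sq_abs, mul_pow, hs, Real.sq_sqrt h3]
    ring
  exact (pow_eq_one_iff_of_nonneg (norm_nonneg _) two_ne_zero).1 this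

/-- Each of the two intersection points of a random line with `S^{n-1}` is uniformly
distributed: the pushforwards of the kinematic measure under the entry-point and
exit-point maps both equal the normalized surface measure `σ`. -/
theorem entry_exit_uniform (n : ℕ) (hn : 2 ≤ n) :
    Measure.map (Xpt n) (kinematic n) = sigmaN n ∧
      Measure.map (Ypt n) (kinematic n) = sigmaN n := by
  constructor
  · apply map_kinematic hn
    · unfold Xpt; fun_prop
    · intro U v z
      simp [Xpt]
    · intro v z hv hz
      have := norm_pt (-1) (by norm_num) v z hv hz
      simpa [Xpt, sub_eq_add_neg] using this
  · apply map_kinematic hn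
    · unfold Ypt; fun_prop
    · intro U v z
      simp [Ypt]
    · intro v z hv hz
      have := norm_pt 1 (by norm_num) v z hv hz
      simpa [Ypt] using this

end
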